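/- Let F be a division ring, α, β ∈ F with α ≠ β but f^ℓ(α)=0 and f^r(β)=0 and (L_α f)^r(β)=0 for f ∈ F[z]. Then f = (z−α)·h·(z−β) for some h ∈ F[z]; in fact h = R_β L_α f. -/

import Mathlib

open Polynomial

/-- Left evaluation of a polynomial `f = Σ zʲ fⱼ` at `a`: `f^ℓ(a) = Σ aʲ fⱼ`.
(Mathlib's `Polynomial.eval` is the right evaluation `Σ fⱼ aʲ`.) -/
noncomputable def lEval {F : Type*} [DivisionRing F] (a : F) (f : F[X]) : F :=
  f.sum fun j c => a ^ j * c

theorem lEval_add {F : Type*} [DivisionRing F] (a : F) (p q : F[X]) :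
    lEval a (p + q) = lEval a p + lEval a q :=
  sum_add_index p q _ (by simp) (by simp [mul_add])

theorem lEval_monomial {F : Type*} [DivisionRing F] (a c : F) (n : ℕ) :
    lEval a (monomial n c) = a ^ n * c :=
  sum_monomial_index c _ (by simp)

/-- Left division by `X - C a`, with the left evaluation as remainder. -/
theorem exists_eq_C_lEval_add_mul {F : Type*} [DivisionRing F] (a : F) (f : F[X]) :
    ∃ q : F[X], f = C (lEval a f) + (X - C a) * q := by
  induction f using Polynomial.induction_on' with
  | add p q hp hq =>
    obtain ⟨u, hu⟩ := hp
    obtain ⟨v, hv⟩ := hq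
    refine ⟨u + v, ?_⟩
    rw [lEval_add, C_add, mul_add, add_add_add_comm, ← hu, ← hv]
  | monomial n c =>
    refine ⟨(∑ i ∈ Finset.range n, X ^ i * C a ^ (n - 1 - i)) * C c, ?_⟩
    rw [lEval_monomial, ← mul_assoc, (commute_X (C a)).mul_geom_sum₂ n, sub_mul, X_pow_mul,
      C_mul_X_pow_eq_monomial, C_mul, C_pow, add_sub_cancel]

/-- Right division by `X - C b`, with the right evaluation as remainder. -/
theorem exists_eq_C_eval_add_mul {F : Type*} [Ring F] (b : F) (f : F[X]) :
    ∃ q : F[X], f = C (f.eval b) + q * (X - C b) := by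
  induction f using Polynomial.induction_on' with
  | add p q hp hq =>
    obtain ⟨u, hu⟩ := hp
    obtain ⟨v, hv⟩ := hq
    refine ⟨u + v, ?_⟩
    rw [eval_add, C_add, add_mul, add_add_add_comm, ← hu, ← hv]
  | monomial n c =>
    refine ⟨C c * ∑ i ∈ Finset.range n, X ^ i * C b ^ (n - 1 - i), ?_⟩
    rw [eval_monomial, mul_assoc, (commute_X (C b)).geom_sum₂_mul n, mul_sub,
      C_mul_X_pow_eq_monomial, C_mul, C_pow, add_sub_cancel]

/-- If f^ℓ(α)=0, f^r(β)=0 and (L_α f)^r(β)=0, then f = (z−α)·h·(z−β);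
in fact h = R_β L_α f. -/
theorem stmt12 {F : Type*} [DivisionRing F] (α β : F) (hab : α ≠ β) (f : F[X])
    (h1 : lEval α f = 0) (h2 : f.eval β = 0)
    (h3 : ∀ q : F[X], f = C (lEval α f) + (X - C α) * q → q.eval β = 0) :
    (∃ h : F[X], f = (X - C α) * h * (X - C β)) ∧
    (∀ qL h : F[X], f = C (lEval α f) + (X - C α) * qL →
      qL = C (qL.eval β) + h * (X - C β) →
      f = (X - C α) * h * (X - C β)) := by
  have key : ∀ qL h : F[X], f = C (lEval α f) + (X - C α) * qL →
      qL = C (qL.eval β) + h * (X - C β) → f = (X - C α) * h * (X - C β) := by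
    intro qL h hf hq
    rw [h3 qL hf, C_0, zero_add] at hq
    rw [h1, C_0, zero_add] at hf
    rw [mul_assoc, ← hq, ← hf]
  obtain ⟨qL, hf⟩ := exists_eq_C_lEval_add_mul α f
  obtain ⟨h, hq⟩ := exists_eq_C_eval_add_mul β qL
  exact ⟨⟨h, key qL h hf hq⟩, key⟩
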